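/- For every unique factorization domain A, there exists a principal ideal domain B and an injective ring homomorphism ι : A → B such that the image ι(A) is factorially closed in B: for all nonzero a, b ∈ B with a·b ∈ ι(A), both a ∈ ι(A) and b ∈ ι(A). -/

import Mathlib

universe u

/-- An embedding of `A` into a PID `B` whose image is factorially closed in `B`. -/
structure FCEmbeddingIntoPID (A : Type u) [CommRing A] where
  /-- the ambient ring -/
  B : Type u
  [commRing : CommRing B]
  [isDomain : IsDomain B]
  [pid : IsPrincipalIdealRing B]
  /-- the embedding -/
  ι : A →+* B
  inj : Function.Injective ι
  fc : ∀ a b : B, a ≠ 0 → b ≠ 0 → a * b ∈ Set.range ι →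
    a ∈ Set.range ι ∧ b ∈ Set.range ι


set_option linter.unusedSectionVars false

namespace FCPID

theorem dvd_of_prime_pow {A : Type u} [CommRing A] [IsDomain A] [UniqueFactorizationMonoid A]
    (N d : A) (hd : d ≠ 0) (h : ∀ p k, Prime p → p ^ k ∣ d → p ^ k ∣ N) : d ∣ N := by
  induction d using UniqueFactorizationMonoid.induction_on_coprime with
  | h0 => exact absurd rfl hd
  | h1 hx => exact hx.dvd
  | hpr i hp => exact h _ _ hp dvd_rfl
  | hcp hxy hx hy =>
    exact IsRelPrime.mul_dvd hxy
      (hx (left_ne_zero_of_mul hd) fun p k hp hpk => h p k hp (hpk.mul_right _))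
      (hy (right_ne_zero_of_mul hd) fun p k hp hpk => h p k hp (hpk.mul_left _))

section abstract_part

variable {A L : Type u} [CommRing A] [IsDomain A] [UniqueFactorizationMonoid A]
  [CommRing L] [IsDomain L] [UniqueFactorizationMonoid L] (c : A →+* L)
  (hu : ∀ a : A, a ≠ 0 → IsUnit (c a))
  (B : Subring L)
  (hA : ∀ a, c a ∈ B)
  (hden : ∀ m : L, ∃ s : A, s ≠ 0 ∧ c s * m ∈ B)
  (hfc : ∀ u v : L, u ∈ B → v ∈ B → u ≠ 0 → v ≠ 0 → (∃ a, c a = u * v) → ∃ a, c a = u)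
  (hp : ∀ p, Prime p → ∀ f ∈ B, ∀ g ∈ B, ∀ h ∈ B, f * g = c p * h →
    (∃ f' ∈ B, f = c p * f') ∨ ∃ g' ∈ B, g = c p * g')
  (hN : ∀ g : L, g ≠ 0 → ∃ N : A, N ≠ 0 ∧ ∀ p k, Prime p → ∀ h ∈ B, g = c p ^ k * h → p ^ k ∣ N)

include hu hfc hA hp in
theorem prime_of_prime (p : A) (hpp : Prime p) : Prime (⟨c p, hA p⟩ : B) := by
  have hinj : Function.Injective c := by
    rw [injective_iff_map_eq_zero]
    intro a ha
    by_contra h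
    exact (hu a h).ne_zero ha
  refine ⟨?_, ?_, ?_⟩
  · intro h
    exact (hu p hpp.ne_zero).ne_zero (congrArg Subtype.val h)
  · intro h
    obtain ⟨v, hv⟩ := isUnit_iff_exists_inv.1 h
    have hv' : c p * (v : L) = 1 := congrArg Subtype.val hv
    have hv0 : (v : L) ≠ 0 := by
      rintro h0
      rw [h0] at hv'
      simp at hv'
    obtain ⟨a, ha⟩ := hfc v (c p) v.2 (hA p) hv0 (hu p hpp.ne_zero).ne_zero
      ⟨1, by rw [mul_comm, hv', map_one]⟩
    rw [← ha, ← map_mul, ← map_one c] at hv'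
    exact hpp.not_isUnit (IsUnit.of_mul_eq_one _ (hinj hv'))
  · rintro f g ⟨h, hfg⟩
    rcases hp p hpp f f.2 g g.2 h h.2 (congrArg Subtype.val hfg) with ⟨f', hf, e⟩ | ⟨f', hf, e⟩
    · exact Or.inl ⟨⟨f', hf⟩, Subtype.ext e⟩
    · exact Or.inr ⟨⟨f', hf⟩, Subtype.ext e⟩

include hu hA hp hN in
/-- extraction of the content -/
theorem exists_content (g : L) (hg : g ≠ 0) (hgB : g ∈ B) :
    ∃ d : A, d ≠ 0 ∧ ∃ g' ∈ B, g = c d * g' ∧ ∀ p, Prime p → ¬ ∃ f ∈ B, g' = c p * f := by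
  obtain ⟨N, hN0, hN⟩ := hN g hg
  have key : ∀ d : A, d ≠ 0 → ∀ g' ∈ B, g = c d * g' → d ∣ N := by
    intro d hd g' hg' e
    refine dvd_of_prime_pow N d hd ?_
    rintro p k hpp ⟨t, rfl⟩
    refine hN p k hpp (c t * g') (B.mul_mem (hA t) hg') ?_
    rw [e, map_mul, map_pow, mul_assoc]
  let S : Set A := {e | ∃ d, d * e = N ∧ ∃ g' ∈ B, g = c d * g'}
  have hS : S.Nonempty := ⟨N, 1, one_mul N, g, hgB, by simp⟩
  obtain ⟨e, ⟨d, hde, g', hg', hgg⟩, hmin⟩ := WellFounded.has_min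
    (wellFounded_dvdNotUnit (α := A)) S hS
  have hd0 : d ≠ 0 := by rintro rfl; simp at hde; exact hN0 hde.symm
  refine ⟨d, hd0, g', hg', hgg, ?_⟩
  rintro p hpp ⟨f, hf, rfl⟩
  have h1 : g = c (d * p) * f := by rw [hgg, map_mul, mul_assoc]
  obtain ⟨e', he'⟩ := key (d * p) (mul_ne_zero hd0 hpp.ne_zero) f hf h1
  refine hmin e' ⟨d * p, he'.symm, f, hf, h1⟩ ?_
  have he : e = e' * p := by
    apply mul_left_cancel₀ hd0
    rw [hde, he']; ring
  refine ⟨?_, p, hpp.not_isUnit, he⟩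
  rintro rfl
  apply hN0
  rw [he', mul_zero]

include hu hA hp hden in
theorem prime_of_primitive (g : L) (hg : Prime g) (hgB : g ∈ B)
    (hprim : ∀ p, Prime p → ¬ ∃ f ∈ B, g = c p * f) : Prime (⟨g, hgB⟩ : B) := by
  have key : ∀ s : A, s ≠ 0 → ∀ m : L, c s * m ∈ B → g * m ∈ B → m ∈ B := by
    intro s
    induction s using UniqueFactorizationMonoid.induction_on_prime with
    | h₁ => intro h; exact absurd rfl h
    | h₂ x hx =>
      intro _ m hm _
      obtain ⟨y, hy⟩ := isUnit_iff_exists_inv'.1 hx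
      have := B.mul_mem (hA y) hm
      rwa [← mul_assoc, ← map_mul, hy, map_one, one_mul] at this
    | h₃ a p ha hpp ih =>
      intro _ m hm hgm
      rcases hp p hpp _ hm _ hgB (c a * (g * m)) (B.mul_mem (hA a) hgm)
        (by rw [map_mul]; ring) with ⟨f, hf, e⟩ | h
      · refine ih ha m ?_ hgm
        rw [map_mul, mul_assoc] at e
        rwa [(hu p hpp.ne_zero).mul_left_cancel e]
      · exact absurd h (hprim p hpp)
  have key2 : ∀ h : B, g ∣ (h : L) → (⟨g, hgB⟩ : B) ∣ h := by
    rintro ⟨h, hh⟩ ⟨m, rfl⟩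
    obtain ⟨s, hs, hsm⟩ := hden m
    exact ⟨⟨m, key s hs m hsm hh⟩, rfl⟩
  refine ⟨?_, ?_, ?_⟩
  · intro h
    exact hg.ne_zero (congrArg Subtype.val h)
  · intro h
    exact hg.not_isUnit (h.map B.subtype)
  · rintro f h ⟨k, hk⟩
    have : g ∣ (f : L) * h := ⟨k, congrArg Subtype.val hk⟩
    exact (hg.dvd_or_dvd this).imp (key2 f) (key2 h)

include hu hA hden hfc hp hN in
theorem ufd_of : UniqueFactorizationMonoid B := by
  rw [UniqueFactorizationMonoid.iff_exists_prime_mem_of_isPrime]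
  intro P hP0 hP
  by_cases hPA : ∃ a : A, a ≠ 0 ∧ (⟨c a, hA a⟩ : B) ∈ P
  · obtain ⟨a, ha, haP⟩ := hPA
    induction a using UniqueFactorizationMonoid.induction_on_prime with
    | h₁ => exact absurd rfl ha
    | h₂ x hx =>
      obtain ⟨y, hy⟩ := isUnit_iff_exists_inv.1 hx
      exact absurd (P.eq_top_of_isUnit_mem haP
        (IsUnit.of_mul_eq_one ⟨c y, hA y⟩ (Subtype.ext (by simp [← map_mul, hy])))) hP.ne_top
    | h₃ a p ha' hpp ih =>
      have : (⟨c p, hA p⟩ : B) * ⟨c a, hA a⟩ ∈ P := by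
        convert haP using 1
        exact Subtype.ext (by simp)
      rcases hP.mem_or_mem this with h | h
      · exact ⟨_, h, prime_of_prime c hu B hA hfc hp p hpp⟩
      · exact ih ha' h
  · push Not at hPA
    have key : ∀ f : L, f ≠ 0 → ∀ s : A, s ≠ 0 → ∀ hf : c s * f ∈ B, (⟨c s * f, hf⟩ : B) ∈ P →
        ∃ x ∈ P, Prime x := by
      intro f
      induction f using UniqueFactorizationMonoid.induction_on_prime with
      | h₁ => intro h; exact absurd rfl h
      | h₂ x hx =>
        intro _ s hs hxB hxP
        exfalso
        obtain ⟨y, hy⟩ := isUnit_iff_exists_inv.1 hx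
        obtain ⟨t, ht, hty⟩ := hden y
        apply hPA (t * s) (mul_ne_zero ht hs)
        have := P.mul_mem_left ⟨_, hty⟩ hxP
        convert this using 1
        refine Subtype.ext ?_
        change c (t * s) = c t * y * (c s * x)
        rw [map_mul]
        linear_combination (- c t * c s) * hy
      | h₃ f q hf hq ih =>
        intro _ s hs hB hfP
        obtain ⟨t, ht, htq⟩ := hden q
        obtain ⟨r, hr, hrf⟩ := hden f
        have : (⟨c s, hA s⟩ : B) * ((⟨_, htq⟩ : B) * ⟨_, hrf⟩) ∈ P := by
          have := P.mul_mem_left ⟨c (t * r), hA _⟩ hfP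
          convert this using 1
          refine Subtype.ext ?_
          change c s * (c t * q * (c r * f)) = c (t * r) * (c s * (q * f))
          rw [map_mul]
          ring
        replace this := (hP.mem_or_mem this).resolve_left (hPA s hs)
        rcases hP.mem_or_mem this with h | h
        · have hq' : Prime (c t * q) :=
            (associated_unit_mul_left q (c t) (hu t ht)).symm.prime hq
          obtain ⟨d, hd, g, hg, hgg, hprim⟩ :=
            exists_content c hu B hA hp hN _ hq'.ne_zero htq
          have hgp : Prime g := by
            rw [hgg] at hq'
            exact (associated_unit_mul_left g (c d) (hu d hd)).prime hq'
          have : (⟨c d, hA d⟩ : B) * ⟨g, hg⟩ ∈ P := by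
            convert h using 1
            exact Subtype.ext hgg.symm
          rcases hP.mem_or_mem this with h | h
          · exact absurd h (hPA d hd)
          · exact ⟨_, h, prime_of_primitive c hu B hA hden hp g hgp hg hprim⟩
        · exact ih hf r hr hrf h
    obtain ⟨f, hf, hf0⟩ := Submodule.exists_mem_ne_zero_of_ne_bot hP0
    refine key f (fun h => hf0 (Subtype.ext h)) 1 one_ne_zero (by simp) ?_
    convert hf using 1
    exact Subtype.ext (by simp)

end abstract_part
end FCPID

namespace FCPID
open MvPolynomial

section concrete
variable {A : Type u} [CommRing A] [IsDomain A] [UniqueFactorizationMonoid A]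
  (K : Type u) [Field K] [Algebra A K] [IsFractionRing A K]

/-- The local ring of `A` at the prime element `p`, inside the fraction field. -/
def locRing (p : A) (hp : Prime p) : Subring K where
  carrier := {x | ∃ a s : A, ¬ p ∣ s ∧ algebraMap A K s * x = algebraMap A K a}
  mul_mem' := by
    rintro x y ⟨a, s, hs, e⟩ ⟨b, t, ht, e'⟩
    refine ⟨a * b, s * t, fun h => (hp.dvd_or_dvd h).elim hs ht, ?_⟩
    rw [map_mul, map_mul, ← e, ← e']; ring
  one_mem' := ⟨1, 1, fun h => hp.not_isUnit (isUnit_of_dvd_one h), by simp⟩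
  add_mem' := by
    rintro x y ⟨a, s, hs, e⟩ ⟨b, t, ht, e'⟩
    refine ⟨a * t + b * s, s * t, fun h => (hp.dvd_or_dvd h).elim hs ht, ?_⟩
    rw [map_mul, map_add, map_mul, map_mul, ← e, ← e']; ring
  zero_mem' := ⟨0, 1, fun h => hp.not_isUnit (isUnit_of_dvd_one h), by simp⟩
  neg_mem' := by
    rintro x ⟨a, s, hs, e⟩
    exact ⟨-a, s, hs, by rw [map_neg, ← e]; ring⟩

theorem mem_locRing {p : A} {hp : Prime p} {x : K} : x ∈ locRing K p hp ↔
    ∃ a s : A, ¬ p ∣ s ∧ algebraMap A K s * x = algebraMap A K a := Iff.rfl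

theorem algebraMap_mem_locRing (p : A) (hp : Prime p) (a : A) :
    algebraMap A K a ∈ locRing K p hp :=
  ⟨a, 1, fun h => hp.not_isUnit (isUnit_of_dvd_one h), by simp⟩

theorem inv_mem_locRing (p : A) (hp : Prime p) (a : A) (ha : ¬ p ∣ a) :
    (algebraMap A K a)⁻¹ ∈ locRing K p hp := by
  refine ⟨1, a, ha, ?_⟩
  have : algebraMap A K a ≠ 0 := by
    intro h
    rw [map_eq_zero_iff _ (IsFractionRing.injective A K)] at h
    exact ha (h ▸ dvd_zero p)
  rw [mul_inv_cancel₀ this, map_one]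

theorem exists_num (x : K) (hx : x ≠ 0) : ∃ u : A, u ≠ 0 ∧
    ∀ p k (hp : Prime p), ∀ y ∈ locRing K p hp, x = algebraMap A K p ^ k * y → p ^ k ∣ u := by
  obtain ⟨u, s, hs, rfl⟩ := IsFractionRing.div_surjective (A := A) x
  have hs0 : algebraMap A K s ≠ 0 := by
    rw [Ne, map_eq_zero_iff _ (IsFractionRing.injective A K)]
    exact nonZeroDivisors.ne_zero hs
  refine ⟨u, ?_, ?_⟩
  · rintro rfl
    simp at hx
  · rintro p k hp y ⟨e, t, ht, hy⟩ h
    rw [div_eq_iff hs0] at h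
    have : u * t = p ^ k * (e * s) := by
      apply IsFractionRing.injective A K
      simp only [map_mul, map_pow]
      rw [h, ← hy]; ring
    exact hp.pow_dvd_of_dvd_mul_right k ht ⟨_, this⟩

theorem prime_in_locRing (p : A) (hp : Prime p) :
    Prime (⟨algebraMap A K p, algebraMap_mem_locRing K p hp p⟩ : locRing K p hp) := by
  have inj := IsFractionRing.injective A K
  refine ⟨?_, ?_, ?_⟩
  · intro h
    have h' : algebraMap A K p = 0 := congrArg Subtype.val h
    rw [map_eq_zero_iff _ inj] at h'
    exact hp.ne_zero h'
  · intro h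
    obtain ⟨⟨v, e, t, ht, hv⟩, h⟩ := isUnit_iff_exists_inv.1 h
    have h' : algebraMap A K p * v = 1 := congrArg Subtype.val h
    apply ht
    refine ⟨e, inj ?_⟩
    rw [map_mul, ← hv]
    linear_combination (- algebraMap A K t) * h'
  · have key : ∀ x : locRing K p hp, ∀ a s : A, ¬ p ∣ s →
        algebraMap A K s * (x : K) = algebraMap A K a → p ∣ a →
        (⟨algebraMap A K p, algebraMap_mem_locRing K p hp p⟩ : locRing K p hp) ∣ x := by
      rintro ⟨x, hx⟩ a s hs e ⟨a', rfl⟩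
      have hs0 : algebraMap A K s ≠ 0 := by
        intro h
        rw [map_eq_zero_iff _ inj] at h
        exact hs (h ▸ dvd_zero p)
      refine ⟨⟨algebraMap A K a' * (algebraMap A K s)⁻¹, Subring.mul_mem _
        (algebraMap_mem_locRing K p hp _) (inv_mem_locRing K p hp s hs)⟩, Subtype.ext ?_⟩
      change x = algebraMap A K p * (algebraMap A K a' * (algebraMap A K s)⁻¹)
      simp only [map_mul] at e
      field_simp
      linear_combination e
    rintro x y ⟨⟨z, d, r, hr, hz⟩, h⟩
    have h' : (x : K) * y = algebraMap A K p * z := congrArg Subtype.val h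
    obtain ⟨a, s, hs, e⟩ := x.2
    obtain ⟨b, t, ht, e'⟩ := y.2
    have : p ∣ (a * b) * r := by
      refine ⟨d * s * t, inj ?_⟩
      simp only [map_mul]
      rw [← e, ← e', ← hz]
      linear_combination algebraMap A K s * algebraMap A K t * algebraMap A K r * h'
    have := (hp.dvd_or_dvd this).resolve_right hr
    exact (hp.dvd_or_dvd this).imp (key x a s hs e) (key y b t ht e')

theorem mem_range_of_forall (x : K) (h : ∀ (p : A) (hp : Prime p), x ∈ locRing K p hp) :
    ∃ a : A, algebraMap A K a = x := by
  have key : ∀ s : A, s ≠ 0 → ∀ x : K, (∀ (p : A) (hp : Prime p), x ∈ locRing K p hp) →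
      (∃ a : A, algebraMap A K a = algebraMap A K s * x) → ∃ a : A, algebraMap A K a = x := by
    intro s
    induction s using UniqueFactorizationMonoid.induction_on_prime with
    | h₁ => intro h; exact absurd rfl h
    | h₂ s hs =>
      rintro _ x _ ⟨a, ha⟩
      obtain ⟨y, hy⟩ := isUnit_iff_exists_inv'.1 hs
      refine ⟨y * a, ?_⟩
      rw [map_mul, ha, ← mul_assoc, ← map_mul, hy, map_one, one_mul]
    | h₃ s p hs hp ih =>
      rintro _ x hx ⟨a, ha⟩
      refine ih hs x hx ?_
      obtain ⟨e, t, ht, hy⟩ := hx p hp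
      have h1 : t * a = p * (s * e) := by
        apply IsFractionRing.injective A K
        simp only [map_mul] at ha ⊢
        rw [ha, ← hy]; ring
      obtain ⟨a', rfl⟩ := (hp.dvd_or_dvd ⟨_, h1⟩).resolve_left ht
      refine ⟨a', ?_⟩
      have hp0 : algebraMap A K p ≠ 0 := by
        rw [Ne, map_eq_zero_iff _ (IsFractionRing.injective A K)]
        exact hp.ne_zero
      apply mul_left_cancel₀ hp0
      simp only [map_mul] at ha
      rw [ha]; ring
  obtain ⟨u, s, hs, e⟩ := IsFractionRing.div_surjective (A := A) x
  have hs0 : algebraMap A K s ≠ 0 := by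
    rw [Ne, map_eq_zero_iff _ (IsFractionRing.injective A K)]
    exact nonZeroDivisors.ne_zero hs
  refine key s (nonZeroDivisors.ne_zero hs) x h ⟨u, ?_⟩
  rw [← e]; field_simp

variable (A) in
/-- The index set of coprime pairs. -/
abbrev Idx : Type u := {q : A × A // q.1 ≠ 0 ∧ IsRelPrime q.1 q.2}

open Classical in
/-- The change of variables attached to `p`. -/
noncomputable def phi (p : A) : MvPolynomial (Idx A) K →ₐ[K] MvPolynomial (Idx A) K :=
  aeval (fun i => if p ∣ i.1.1 then
    C (algebraMap A K i.1.2)⁻¹ - C (algebraMap A K i.1.1 * (algebraMap A K i.1.2)⁻¹) * X i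
    else X i)

open Classical in
/-- The inverse change of variables. -/
noncomputable def psi (p : A) : MvPolynomial (Idx A) K →ₐ[K] MvPolynomial (Idx A) K :=
  aeval (fun i => if p ∣ i.1.1 then
    C (algebraMap A K i.1.1)⁻¹ - C (algebraMap A K i.1.2 * (algebraMap A K i.1.1)⁻¹) * X i
    else X i)

theorem not_dvd_snd (p : A) (hp : Prime p) (i : Idx A) (h : p ∣ i.1.1) : ¬ p ∣ i.1.2 :=
  fun h' => hp.not_isUnit (i.2.2 h h')

theorem fst_ne (i : Idx A) : algebraMap A K i.1.1 ≠ 0 := by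
  rw [Ne, map_eq_zero_iff _ (IsFractionRing.injective A K)]
  exact i.2.1

theorem snd_ne (p : A) (hp : Prime p) (i : Idx A) (h : p ∣ i.1.1) : algebraMap A K i.1.2 ≠ 0 := by
  rw [Ne, map_eq_zero_iff _ (IsFractionRing.injective A K)]
  intro h0
  exact not_dvd_snd p hp i h (by rw [h0]; exact dvd_zero p)

theorem psi_phi (p : A) (hp : Prime p) (f : MvPolynomial (Idx A) K) : psi K p (phi K p f) = f := by
  have : (psi K p).comp (phi K p) = AlgHom.id K _ := by
    apply MvPolynomial.algHom_ext
    intro i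
    simp only [AlgHom.comp_apply, phi, aeval_X, AlgHom.id_apply]
    split_ifs with h
    · have h1 := fst_ne K i
      have h2 := snd_ne K p hp i h
      have h3 : ∀ r : K, psi K p (C r) = C r := fun r => (psi K p).commutes r
      have h4 : psi K p (X i) = C (algebraMap A K i.1.1)⁻¹ -
          C (algebraMap A K i.1.2 * (algebraMap A K i.1.1)⁻¹) * X i := by
        simp only [psi, aeval_X, if_pos h]
      rw [map_sub, map_mul, h3, h3, h4, mul_sub, ← mul_assoc, ← C_mul, ← C_mul]
      have e1 : algebraMap A K i.1.1 * (algebraMap A K i.1.2)⁻¹ * (algebraMap A K i.1.1)⁻¹ =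
        (algebraMap A K i.1.2)⁻¹ := by field_simp
      have e2 : algebraMap A K i.1.1 * (algebraMap A K i.1.2)⁻¹ *
        (algebraMap A K i.1.2 * (algebraMap A K i.1.1)⁻¹) = 1 := by field_simp
      rw [e1, e2, C_1]; ring
    · simp only [psi, aeval_X, if_neg h]
  exact DFunLike.congr_fun this f

theorem phi_C (p : A) (r : K) : phi K p (C r) = C r := (phi K p).commutes r

/-- The ring of polynomials that are integral at `p`. -/
noncomputable def locPoly (p : A) (hp : Prime p) : Subring (MvPolynomial (Idx A) K) :=
  ((map (locRing K p hp).subtype).range).comap (phi K p).toRingHom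

theorem mem_locPoly {p : A} {hp : Prime p} {f : MvPolynomial (Idx A) K} :
    f ∈ locPoly K p hp ↔ ∃ F : MvPolynomial (Idx A) (locRing K p hp),
      map (locRing K p hp).subtype F = phi K p f := Iff.rfl

theorem coeff_mem {p : A} {hp : Prime p} {f : MvPolynomial (Idx A) K} (hf : f ∈ locPoly K p hp)
    (m : Idx A →₀ ℕ) : coeff m (phi K p f) ∈ locRing K p hp := by
  obtain ⟨F, hF⟩ := (mem_locPoly K).1 hf
  rw [← hF, coeff_map]
  exact (coeff m F).2

theorem C_mem_locPoly {p : A} {hp : Prime p} {r : K} :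
    C r ∈ locPoly K p hp ↔ r ∈ locRing K p hp := by
  constructor
  · intro h
    have := coeff_mem K h 0
    rwa [phi_C, coeff_zero_C] at this
  · intro h
    exact (mem_locPoly K).2 ⟨C ⟨r, h⟩, by rw [map_C, phi_C]; rfl⟩

theorem X_mem_locPoly {p : A} {hp : Prime p} (i : Idx A) : X i ∈ locPoly K p hp := by
  by_cases h : p ∣ i.1.1
  · have hb := inv_mem_locRing K p hp _ (not_dvd_snd p hp i h)
    have ha := algebraMap_mem_locRing K p hp i.1.1
    refine (mem_locPoly K).2 ⟨C ⟨_, hb⟩ - C ⟨_, Subring.mul_mem _ ha hb⟩ * X i, ?_⟩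
    simp only [phi, aeval_X, if_pos h, map_sub, map_mul, map_C, map_X, Subring.subtype_apply]
  · refine (mem_locPoly K).2 ⟨X i, ?_⟩
    simp only [phi, aeval_X, if_neg h, map_X]

/-- The complementary variable. -/
noncomputable def Y (i : Idx A) : MvPolynomial (Idx A) K :=
  C (algebraMap A K i.1.1)⁻¹ - C (algebraMap A K i.1.2 * (algebraMap A K i.1.1)⁻¹) * X i

theorem Y_mem_locPoly {p : A} {hp : Prime p} (i : Idx A) : Y K i ∈ locPoly K p hp := by
  by_cases h : p ∣ i.1.1
  · refine (mem_locPoly K).2 ⟨X i, ?_⟩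
    have h1 := fst_ne K i
    have h2 := snd_ne K p hp i h
    rw [map_X, Y, map_sub, map_mul, phi_C, phi_C]
    simp only [phi, aeval_X, if_pos h]
    rw [mul_sub, ← mul_assoc, ← C_mul, ← C_mul]
    have e1 : algebraMap A K i.1.2 * (algebraMap A K i.1.1)⁻¹ * (algebraMap A K i.1.2)⁻¹ =
      (algebraMap A K i.1.1)⁻¹ := by field_simp
    have e2 : algebraMap A K i.1.2 * (algebraMap A K i.1.1)⁻¹ *
      (algebraMap A K i.1.1 * (algebraMap A K i.1.2)⁻¹) = 1 := by field_simp
    rw [e1, e2, C_1]; ring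
  · have ha := inv_mem_locRing K p hp _ h
    have hb := algebraMap_mem_locRing K p hp i.1.2
    exact Subring.sub_mem _ ((C_mem_locPoly K).2 ha)
      (Subring.mul_mem _ ((C_mem_locPoly K).2 (Subring.mul_mem _ hb ha)) (X_mem_locPoly K i))

/-- The one-step extension. -/
noncomputable def stepRing : Subring (MvPolynomial (Idx A) K) :=
  ⨅ p : {p : A // Prime p}, locPoly K p.1 p.2

theorem mem_stepRing {f : MvPolynomial (Idx A) K} :
    f ∈ stepRing K ↔ ∀ p (hp : Prime p), f ∈ locPoly K p hp := by
  rw [stepRing, Subring.mem_iInf]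
  exact ⟨fun h p hp => h ⟨p, hp⟩, fun h p => h p.1 p.2⟩

variable (A) in
/-- The inclusion of `A`. -/
noncomputable def incl : A →+* MvPolynomial (Idx A) K := C.comp (algebraMap A K)

theorem incl_apply (a : A) : incl A K a = C (algebraMap A K a) := rfl

theorem incl_mem (a : A) : incl A K a ∈ stepRing K :=
  (mem_stepRing K).2 fun p hp => (C_mem_locPoly K).2 (algebraMap_mem_locRing K p hp a)

theorem step_hu (a : A) (ha : a ≠ 0) : IsUnit (incl A K a) := by
  have : algebraMap A K a ≠ 0 := by
    rwa [Ne, map_eq_zero_iff _ (IsFractionRing.injective A K)]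
  exact (IsUnit.mk0 _ this).map C

theorem step_hden (m : MvPolynomial (Idx A) K) : ∃ s : A, s ≠ 0 ∧ incl A K s * m ∈ stepRing K := by
  induction m using MvPolynomial.induction_on with
  | C r =>
    obtain ⟨u, s, hs, rfl⟩ := IsFractionRing.div_surjective (A := A) r
    have hs0 : algebraMap A K s ≠ 0 := by
      rw [Ne, map_eq_zero_iff _ (IsFractionRing.injective A K)]
      exact nonZeroDivisors.ne_zero hs
    refine ⟨s, nonZeroDivisors.ne_zero hs, ?_⟩
    rw [incl_apply, ← C_mul, mul_div_cancel₀ _ hs0]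
    exact incl_mem K u
  | add f g hf hg =>
    obtain ⟨s, hs, h1⟩ := hf
    obtain ⟨t, ht, h2⟩ := hg
    refine ⟨s * t, mul_ne_zero hs ht, ?_⟩
    have := Subring.add_mem _ (Subring.mul_mem _ (incl_mem K t) h1)
      (Subring.mul_mem _ (incl_mem K s) h2)
    convert this using 1
    rw [map_mul]; ring
  | mul_X f i hf =>
    obtain ⟨s, hs, h1⟩ := hf
    refine ⟨s, hs, ?_⟩
    rw [← mul_assoc]
    exact Subring.mul_mem _ h1 ((mem_stepRing K).2 fun p hp => X_mem_locPoly K i)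

theorem step_hfc (u v : MvPolynomial (Idx A) K) (hu : u ∈ stepRing K) (_ : v ∈ stepRing K)
    (hu0 : u ≠ 0) (hv0 : v ≠ 0) (h : ∃ a, incl A K a = u * v) : ∃ a, incl A K a = u := by
  obtain ⟨a, ha⟩ := h
  have hd : u.totalDegree = 0 := by
    have := totalDegree_mul_of_isDomain hu0 hv0
    rw [← ha, incl_apply, totalDegree_C] at this
    omega
  rw [totalDegree_eq_zero_iff_eq_C] at hd
  rw [hd] at hu ⊢
  obtain ⟨b, hb⟩ := mem_range_of_forall K (coeff 0 u)
    fun p hp => (C_mem_locPoly K).1 ((mem_stepRing K).1 hu p hp)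
  exact ⟨b, by rw [incl_apply, hb]⟩

theorem phi_congr (p q : A) (h : Associated p q) : phi K p = phi K q := by
  have : ∀ a, (p ∣ a) = (q ∣ a) := fun a => propext h.dvd_iff_dvd_left
  unfold phi
  congr 1
  funext i
  by_cases hd : p ∣ i.1.1
  · rw [if_pos hd, if_pos (this _ ▸ hd)]
  · rw [if_neg hd, if_neg (this _ ▸ hd)]

theorem locRing_congr (p q : A) (hp : Prime p) (hq : Prime q) (h : Associated p q) :
    locRing K p hp = locRing K q hq := by
  ext x
  rw [mem_locRing, mem_locRing]
  simp only [h.dvd_iff_dvd_left]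

theorem div_mem (p : A) (hp : Prime p) (f : MvPolynomial (Idx A) K) (hf : f ∈ stepRing K)
    (F : MvPolynomial (Idx A) (locRing K p hp)) (hF : map (locRing K p hp).subtype F = phi K p f)
    (hd : C ⟨algebraMap A K p, algebraMap_mem_locRing K p hp p⟩ ∣ F) :
    ∃ f' ∈ stepRing K, f = incl A K p * f' := by
  obtain ⟨F', rfl⟩ := hd
  have hp0 : algebraMap A K p ≠ 0 := by
    rw [Ne, map_eq_zero_iff _ (IsFractionRing.injective A K)]
    exact hp.ne_zero
  refine ⟨C (algebraMap A K p)⁻¹ * f, (mem_stepRing K).2 fun q hq => ?_, ?_⟩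
  · by_cases h : q ∣ p
    · have h := (hq.dvd_prime_iff_associated hp).1 h
      have hpp : C (algebraMap A K p)⁻¹ * f ∈ locPoly K p hp := by
        refine (mem_locPoly K).2 ⟨F', ?_⟩
        rw [map_mul, phi_C, ← hF, map_mul, map_C, ← mul_assoc, Subring.subtype_apply, ← C_mul,
          inv_mul_cancel₀ hp0, C_1, one_mul]
      have e : locPoly K q hq = locPoly K p hp := by
        unfold locPoly
        rw [phi_congr K q p h, locRing_congr K q p hq hp h]
      rw [e]
      exact hpp
    · exact Subring.mul_mem _ ((C_mem_locPoly K).2 (inv_mem_locRing K q hq p h))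
        ((mem_stepRing K).1 hf q hq)
  · rw [incl_apply, ← mul_assoc, ← C_mul, mul_inv_cancel₀ hp0, C_1, one_mul]

theorem step_hp (p : A) (hp : Prime p) (f : MvPolynomial (Idx A) K) (hf : f ∈ stepRing K)
    (g : MvPolynomial (Idx A) K) (hg : g ∈ stepRing K)
    (h : MvPolynomial (Idx A) K) (hh : h ∈ stepRing K) (e : f * g = incl A K p * h) :
    (∃ f' ∈ stepRing K, f = incl A K p * f') ∨ ∃ g' ∈ stepRing K, g = incl A K p * g' := by
  obtain ⟨F, hF⟩ := (mem_locPoly K).1 ((mem_stepRing K).1 hf p hp)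
  obtain ⟨G, hG⟩ := (mem_locPoly K).1 ((mem_stepRing K).1 hg p hp)
  obtain ⟨H, hH⟩ := (mem_locPoly K).1 ((mem_stepRing K).1 hh p hp)
  have hpr := (prime_C_iff (Idx A)).2 (prime_in_locRing K p hp)
  have : F * G = C ⟨algebraMap A K p, algebraMap_mem_locRing K p hp p⟩ * H := by
    apply map_injective (locRing K p hp).subtype (Subring.subtype_injective _)
    rw [map_mul, map_mul, hF, hG, hH, map_C, ← map_mul, e, map_mul, incl_apply, phi_C]
    rfl
  exact (hpr.dvd_or_dvd ⟨H, this⟩).imp (div_mem K p hp f hf F hF) (div_mem K p hp g hg G hG)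

theorem step_hN (g : MvPolynomial (Idx A) K) (hg : g ≠ 0) : ∃ N : A, N ≠ 0 ∧
    ∀ p k, Prime p → ∀ h ∈ stepRing K, g = incl A K p ^ k * h → p ^ k ∣ N := by
  have key : ∀ g' : MvPolynomial (Idx A) K, g' ≠ 0 → ∃ u : A, u ≠ 0 ∧
      ∀ p k, Prime p → ∀ h ∈ stepRing K, phi K p g = g' → g = incl A K p ^ k * h → p ^ k ∣ u := by
    intro g' hg'
    obtain ⟨m, hm⟩ := ne_zero_iff.1 hg'
    obtain ⟨u, hu0, hu⟩ := exists_num (A := A) K _ hm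
    refine ⟨u, hu0, ?_⟩
    intro p k hp h hh e1 e2
    refine hu p k hp _ (coeff_mem K ((mem_stepRing K).1 hh p hp) m) ?_
    rw [← e1, e2, map_mul, map_pow, incl_apply, phi_C, ← C_pow, coeff_C_mul]
  have key2 : ∀ q : A, ∃ u : A, u ≠ 0 ∧ (Prime q →
      ∀ p k, Prime p → Associated p q → ∀ h ∈ stepRing K, g = incl A K p ^ k * h → p ^ k ∣ u) := by
    intro q
    by_cases hq : Prime q
    · obtain ⟨u, hu0, hu⟩ := key (phi K q g) (by
        intro h
        apply hg
        rw [← psi_phi K q hq g, h, map_zero])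
      exact ⟨u, hu0, fun _ p k hp hpq h hh e => hu p k hp h hh (by rw [phi_congr K p q hpq]) e⟩
    · exact ⟨1, one_ne_zero, fun h => absurd h hq⟩
  choose u hu0 hu using key2
  obtain ⟨u0, hu00, hu1⟩ := key g hg
  classical
  let α : A := ∏ i ∈ g.vars, i.1.1
  have hα : α ≠ 0 := Finset.prod_ne_zero_iff.2 fun i _ => i.2.1
  refine ⟨u0 * ((UniqueFactorizationMonoid.factors α).map u).prod, mul_ne_zero hu00 ?_, ?_⟩
  · apply Multiset.prod_ne_zero
    intro h
    obtain ⟨q, _, hq⟩ := Multiset.mem_map.1 h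
    exact hu0 q hq
  · intro p k hp h hh e
    by_cases hpα : p ∣ α
    · obtain ⟨q, hq, hpq⟩ :=
        UniqueFactorizationMonoid.exists_mem_factors_of_dvd hα hp.irreducible hpα
      exact ((hu q (UniqueFactorizationMonoid.prime_of_factor q hq) p k hp hpq h hh e).trans
        (Multiset.dvd_prod (Multiset.mem_map_of_mem u hq))).mul_left _
    · refine (hu1 p k hp h hh ?_ e).mul_right _
      have : (phi K p : MvPolynomial (Idx A) K →+* MvPolynomial (Idx A) K) g =
          RingHom.id (MvPolynomial (Idx A) K) g := by
        apply hom_congr_vars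
        · ext r
          simp
        · intro i hi _
          have : ¬ p ∣ i.1.1 := fun hd => hpα (hd.trans (Finset.dvd_prod_of_mem _ hi))
          simp [phi, this]
        · rfl
      exact this

end concrete

/-- One step: all coprime pairs of `A` become comaximal. -/
theorem exists_step_aux (A : Type u) [CommRing A] [IsDomain A] [UniqueFactorizationMonoid A]
    (K : Type u) [Field K] [Algebra A K] [IsFractionRing A K] :
    ∃ (B : Type u) (_ : CommRing B) (_ : IsDomain B) (_ : UniqueFactorizationMonoid B)
      (f : A →+* B), Function.Injective f ∧
      (∀ a b : B, a ≠ 0 → b ≠ 0 → a * b ∈ Set.range f → a ∈ Set.range f) ∧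
      ∀ a b : A, IsRelPrime a b → IsCoprime (f a) (f b) := by
  have hU : UniqueFactorizationMonoid (stepRing (A := A) K) :=
    ufd_of (incl A K) (step_hu K) (stepRing K) (incl_mem K) (step_hden K) (step_hfc K)
      (step_hp K) (step_hN K)
  refine ⟨stepRing (A := A) K, inferInstance, inferInstance, hU,
    (incl A K).codRestrict (stepRing K) (incl_mem K), ?_, ?_, ?_⟩
  · intro a b h
    have h' : incl A K a = incl A K b := congrArg Subtype.val h
    exact IsFractionRing.injective A K (C_injective _ _ h')
  · rintro a b ha hb ⟨c, hc⟩
    have hc' : incl A K c = (a : MvPolynomial (Idx A) K) * b := congrArg Subtype.val hc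
    obtain ⟨d, hd⟩ := step_hfc K a b a.2 b.2 (fun h => ha (Subtype.ext h))
      (fun h => hb (Subtype.ext h)) ⟨c, hc'⟩
    exact ⟨d, Subtype.ext hd⟩
  · intro a b hab
    by_cases ha : a = 0
    · subst ha
      have hb : IsUnit b := hab (dvd_zero b) dvd_rfl
      exact (isCoprime_zero_left.2 hb).map _
    · let i : Idx A := ⟨(a, b), ha, hab⟩
      refine ⟨⟨Y K i, (mem_stepRing K).2 fun p hp => Y_mem_locPoly K i⟩,
        ⟨X i, (mem_stepRing K).2 fun p hp => X_mem_locPoly K i⟩, Subtype.ext ?_⟩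
      change Y K i * C (algebraMap A K a) + X i * C (algebraMap A K b) = 1
      have h1 : algebraMap A K a ≠ 0 := fst_ne K i
      have e1 : C (σ := Idx A) (algebraMap A K a)⁻¹ * C (algebraMap A K a) = 1 := by
        rw [← C_mul, inv_mul_cancel₀ h1, C_1]
      simp only [Y, i, C_mul]
      linear_combination (1 - C (algebraMap A K b) * X i) * e1

theorem exists_step (A : Type u) [CommRing A] [IsDomain A] [UniqueFactorizationMonoid A] :
    ∃ (B : Type u) (_ : CommRing B) (_ : IsDomain B) (_ : UniqueFactorizationMonoid B)
      (f : A →+* B), Function.Injective f ∧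
      (∀ a b : B, a ≠ 0 → b ≠ 0 → a * b ∈ Set.range f → a ∈ Set.range f) ∧
      ∀ a b : A, IsRelPrime a b → IsCoprime (f a) (f b) :=
  exists_step_aux A (FractionRing A)

end FCPID

namespace FCPID

section limit
variable (G : ℕ → Type u) [∀ n, CommRing (G n)] (f : ∀ n, G n →+* G (n + 1))

/-- Iterated transition maps. -/
def trans (m n : ℕ) (h : m ≤ n) : G m →+* G n :=
  Nat.leRecOn (C := fun k => G m →+* G k) h (fun {k} g => (f k).comp g) (RingHom.id _)

theorem trans_self (m : ℕ) : trans G f m m le_rfl = RingHom.id _ :=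
  Nat.leRecOn_self _

theorem trans_succ (m n : ℕ) (h : m ≤ n) :
    trans G f m (n + 1) (h.trans n.le_succ) = (f n).comp (trans G f m n h) :=
  Nat.leRecOn_succ (C := fun k => G m →+* G k) h _

theorem trans_trans (m n k : ℕ) (h : m ≤ n) (h' : n ≤ k) (x : G m) :
    trans G f n k h' (trans G f m n h x) = trans G f m k (h.trans h') x := by
  induction k, h' using Nat.le_induction with
  | base => rw [trans_self]; rfl
  | succ k h' ih =>
    rw [trans_succ G f n k h', trans_succ G f m k (h.trans h'), RingHom.comp_apply, ih]; rfl

instance directedTrans : DirectedSystem G (fun i j h => trans G f i j h) where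
  map_self i x := by rw [trans_self]; rfl
  map_map k j i h h' x := trans_trans G f i j k h h' x

variable (hinj : ∀ n, Function.Injective (f n))
  (hfc : ∀ n, ∀ a b : G (n + 1), a ≠ 0 → b ≠ 0 → a * b ∈ Set.range (f n) → a ∈ Set.range (f n))

include hinj in
theorem trans_injective (m n : ℕ) (h : m ≤ n) : Function.Injective (trans G f m n h) := by
  induction n, h using Nat.le_induction with
  | base => rw [trans_self]; exact Function.injective_id
  | succ k h ih => rw [trans_succ G f m k h]; exact (hinj k).comp ih

include hinj hfc in
theorem trans_fc (m n : ℕ) (h : m ≤ n) (a b : G n) (ha : a ≠ 0) (hb : b ≠ 0)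
    (hab : a * b ∈ Set.range (trans G f m n h)) : a ∈ Set.range (trans G f m n h) := by
  induction n, h using Nat.le_induction with
  | base => rw [trans_self]; exact ⟨a, rfl⟩
  | succ k h ih =>
    rw [trans_succ G f m k h] at hab ⊢
    obtain ⟨c, hc⟩ := hab
    rw [RingHom.comp_apply] at hc
    obtain ⟨a', rfl⟩ := hfc k a b ha hb ⟨_, hc⟩
    obtain ⟨b', rfl⟩ := hfc k b (f k a') hb ha ⟨_, hc.trans (mul_comm _ _)⟩
    rw [← map_mul] at hc
    obtain ⟨d, rfl⟩ := ih a' b' (fun h => ha (by rw [h, map_zero])) (fun h => hb (by rw [h, map_zero]))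
      ⟨c, hinj k hc⟩
    exact ⟨d, rfl⟩

variable (D : Type u) [CommRing D] (o : ∀ n, G n →+* D)
  (oinj : ∀ n, Function.Injective (o n)) (osurj : ∀ d : D, ∃ n x, o n x = d)
  (otrans : ∀ m n h x, o n (trans G f m n h x) = o m x)

include osurj otrans in
theorem ex_stage (d : D) : ∃ n, ∀ k, n ≤ k → ∃ x, o k x = d := by
  obtain ⟨n, x, rfl⟩ := osurj d
  exact ⟨n, fun k hk => ⟨trans G f n k hk x, otrans n k hk x⟩⟩

include osurj otrans in
theorem ex_stage₂ (m : ℕ) (a b : D) : ∃ k, m ≤ k ∧ ∃ x y, o k x = a ∧ o k y = b := by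
  obtain ⟨n₁, h₁⟩ := ex_stage G f D o osurj otrans a
  obtain ⟨n₂, h₂⟩ := ex_stage G f D o osurj otrans b
  obtain ⟨x, hx⟩ := h₁ (max m (max n₁ n₂)) (by simp)
  obtain ⟨y, hy⟩ := h₂ (max m (max n₁ n₂)) (by simp)
  exact ⟨_, le_max_left _ _, x, y, hx, hy⟩

include oinj osurj otrans in
theorem lim_domain [∀ n, IsDomain (G n)] : IsDomain D := by
  have : Nontrivial D := (oinj 0).nontrivial
  have : NoZeroDivisors D := by
    refine ⟨?_⟩
    intro a b hab
    obtain ⟨k, _, x, y, rfl, rfl⟩ := ex_stage₂ G f D o osurj otrans 0 a b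
    rw [← map_mul, map_eq_zero_iff _ (oinj k)] at hab
    rcases mul_eq_zero.1 hab with rfl | rfl <;> simp
  exact NoZeroDivisors.to_isDomain D

include hinj hfc oinj osurj otrans in
theorem lim_fc (m : ℕ) (a b : D) (ha : a ≠ 0) (hb : b ≠ 0)
    (hab : a * b ∈ Set.range (o m)) : a ∈ Set.range (o m) := by
  obtain ⟨k, hk, x, y, rfl, rfl⟩ := ex_stage₂ G f D o osurj otrans m a b
  obtain ⟨c, hc⟩ := hab
  rw [← otrans m k hk, ← map_mul] at hc
  obtain ⟨d, rfl⟩ := trans_fc G f hinj hfc m k hk x y (fun h => ha (by rw [h, map_zero]))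
    (fun h => hb (by rw [h, map_zero])) ⟨c, oinj k hc⟩
  exact ⟨d, (otrans _ _ _ _).symm⟩

include hinj hfc oinj osurj otrans in
theorem lim_prime [∀ n, IsDomain (G n)] [∀ n, UniqueFactorizationMonoid (G n)]
    (m : ℕ) (p : G m) (hp : Prime p) : Prime (o m p) := by
  have hD := lim_domain G f D o oinj osurj otrans
  have hnu : ∀ q : G m, IsUnit (o m q) → IsUnit q := by
    intro q h
    obtain ⟨v, hv⟩ := isUnit_iff_exists_inv.1 h
    have hv0 : v ≠ 0 := by rintro rfl; simp at hv
    obtain ⟨w, rfl⟩ := lim_fc G f hinj hfc D o oinj osurj otrans m v (o m q) hv0 h.ne_zero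
      ⟨1, by rw [mul_comm, hv, map_one]⟩
    rw [← map_mul, ← map_one (o m)] at hv
    exact IsUnit.of_mul_eq_one _ (oinj m hv)
  have hpr : ∀ k (hk : m ≤ k), Prime (trans G f m k hk p) := by
    intro k hk
    rw [← UniqueFactorizationMonoid.irreducible_iff_prime]
    have hp0 : trans G f m k hk p ≠ 0 := by
      rw [Ne, map_eq_zero_iff _ (trans_injective G f hinj m k hk)]
      exact hp.ne_zero
    refine ⟨?_, ?_⟩
    · intro h
      apply hp.not_isUnit
      apply hnu
      rw [← otrans m k hk]
      exact h.map _
    · intro a b hab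
      have ha0 : a ≠ 0 := by rintro rfl; rw [zero_mul] at hab; exact hp0 hab
      have hb0 : b ≠ 0 := by rintro rfl; rw [mul_zero] at hab; exact hp0 hab
      obtain ⟨a', rfl⟩ := trans_fc G f hinj hfc m k hk a b ha0 hb0 ⟨p, hab⟩
      obtain ⟨b', rfl⟩ := trans_fc G f hinj hfc m k hk b _ hb0 ha0 ⟨p, hab.trans (mul_comm _ _)⟩
      rw [← map_mul] at hab
      exact (hp.irreducible.isUnit_or_isUnit (trans_injective G f hinj m k hk hab)).imp
        (fun h => h.map _) (fun h => h.map _)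
  refine ⟨?_, fun h => hp.not_isUnit (hnu p h), ?_⟩
  · rw [Ne, map_eq_zero_iff _ (oinj m)]
    exact hp.ne_zero
  · rintro a b ⟨c, hc⟩
    obtain ⟨k₁, hk₁, _, c', -, rfl⟩ := ex_stage₂ G f D o osurj otrans m 0 c
    obtain ⟨k, hk, x, y, rfl, rfl⟩ := ex_stage₂ G f D o osurj otrans k₁ a b
    rw [← otrans k₁ k hk, ← otrans m k (hk₁.trans hk), ← map_mul, ← map_mul] at hc
    rw [← otrans m k (hk₁.trans hk)]
    exact ((hpr k (hk₁.trans hk)).dvd_or_dvd ⟨_, oinj k hc⟩).imp (map_dvd _) (map_dvd _)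

include hinj hfc oinj osurj otrans in
theorem lim_pid [∀ n, IsDomain (G n)] [∀ n, UniqueFactorizationMonoid (G n)]
    (hcop : ∀ n (a b : G n), IsRelPrime a b → IsCoprime (f n a) (f n b)) :
    IsPrincipalIdealRing D := by
  have hD := lim_domain G f D o oinj osurj otrans
  have hU : UniqueFactorizationMonoid D := by
    rw [UniqueFactorizationMonoid.iff_exists_prime_mem_of_isPrime]
    intro P hP0 hP
    obtain ⟨d, hd, hd0⟩ := Submodule.exists_mem_ne_zero_of_ne_bot hP0
    obtain ⟨n, x, rfl⟩ := osurj d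
    have hx : x ≠ 0 := by rintro rfl; simp at hd0
    clear hd0
    induction x using UniqueFactorizationMonoid.induction_on_prime with
    | h₁ => exact absurd rfl hx
    | h₂ x hu => exact absurd (P.eq_top_of_isUnit_mem hd (hu.map _)) hP.ne_top
    | h₃ a p ha hp ih =>
      rw [map_mul] at hd
      rcases hP.mem_or_mem hd with h | h
      · exact ⟨_, h, lim_prime G f hinj hfc D o oinj osurj otrans n p hp⟩
      · exact ih h ha
  have hB : IsBezout D := by
    rw [IsBezout.iff_span_pair_isPrincipal]
    intro a b
    obtain ⟨n, _, x, y, rfl, rfl⟩ := ex_stage₂ G f D o osurj otrans 0 a b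
    by_cases hx : x = 0
    · subst hx
      refine ⟨⟨o n y, ?_⟩⟩
      simp [Ideal.span_insert]
    obtain ⟨x', y', d, hrel, rfl, rfl⟩ := UniqueFactorizationMonoid.exists_reduced_factors x hx y
    obtain ⟨u, v, huv⟩ := hcop n x' y' hrel
    have huv' : o (n + 1) u * o n x' + o (n + 1) v * o n y' = 1 := by
      have ho : ∀ z, o (n + 1) (f n z) = o n z := by
        intro z
        rw [← otrans n (n + 1) n.le_succ, trans_succ G f n n le_rfl, trans_self]
        rfl
      rw [← ho, ← ho, ← map_mul, ← map_mul, ← map_add, huv, map_one]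
    refine ⟨⟨o n d, ?_⟩⟩
    change Ideal.span _ = Ideal.span _
    apply le_antisymm
    · rw [Ideal.span_le]
      rintro z (rfl | rfl)
      · exact Ideal.mem_span_singleton.2 (map_dvd _ ⟨x', by ring⟩)
      · exact Ideal.mem_span_singleton.2 (map_dvd _ ⟨y', by ring⟩)
    · rw [Ideal.span_singleton_le_iff_mem, Ideal.mem_span_pair]
      refine ⟨o (n + 1) u, o (n + 1) v, ?_⟩
      simp only [map_mul]
      linear_combination o n d * huv'
  exact ((IsBezout.TFAE (R := D)).out 1 2).2 hU

end limit

/-- A bundled UFD. -/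
structure Obj : Type (u + 1) where
  /-- the carrier -/
  R : Type u
  [ring : CommRing R]
  [dom : IsDomain R]
  [ufd : UniqueFactorizationMonoid R]

attribute [instance] Obj.ring Obj.dom Obj.ufd

theorem exists_next (X : Obj.{u}) : ∃ (Y : Obj.{u}) (f : X.R →+* Y.R), Function.Injective f ∧
    (∀ a b : Y.R, a ≠ 0 → b ≠ 0 → a * b ∈ Set.range f → a ∈ Set.range f) ∧
    ∀ a b : X.R, IsRelPrime a b → IsCoprime (f a) (f b) := by
  obtain ⟨B, i1, i2, i3, f, h⟩ := exists_step X.R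
  exact ⟨⟨B⟩, f, h⟩

/-- The next ring. -/
noncomputable def next (X : Obj.{u}) : Obj.{u} := (exists_next X).choose

/-- The tower of rings. -/
noncomputable def tower (X : Obj.{u}) : ℕ → Obj.{u}
  | 0 => X
  | n + 1 => next (tower X n)

end FCPID

/-- Every UFD embeds into a PID as a factorially closed subring (Cohn). -/
theorem exists_fc_embedding_into_pid (A : Type u) [CommRing A] [IsDomain A]
    [UniqueFactorizationMonoid A] :
    Nonempty (FCEmbeddingIntoPID A) := by
  let T := FCPID.tower ⟨A⟩
  have hT : ∀ n, ∃ f : (T n).R →+* (T (n + 1)).R, Function.Injective f ∧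
      (∀ a b : (T (n + 1)).R, a ≠ 0 → b ≠ 0 → a * b ∈ Set.range f → a ∈ Set.range f) ∧
      ∀ a b : (T n).R, IsRelPrime a b → IsCoprime (f a) (f b) :=
    fun n => (FCPID.exists_next (T n)).choose_spec
  choose f hinj hfc hcop using hT
  let G : ℕ → Type u := fun n => (T n).R
  let D := Ring.DirectLimit G (fun i j h => FCPID.trans G f i j h)
  let o : ∀ n, G n →+* D := fun n => Ring.DirectLimit.of G (fun i j h => FCPID.trans G f i j h) n
  have oinj : ∀ n, Function.Injective (o n) := fun n =>
    Ring.DirectLimit.of_injective (fun i j h => FCPID.trans G f i j h)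
      (fun i j h => FCPID.trans_injective G f hinj i j h) n
  have osurj : ∀ d : D, ∃ n x, o n x = d := fun d => Ring.DirectLimit.exists_of d
  have otrans : ∀ m n h x, o n (FCPID.trans G f m n h x) = o m x := fun m n h x =>
    Ring.DirectLimit.of_f h x
  have i1 : IsDomain D := FCPID.lim_domain G f D o oinj osurj otrans
  have i2 : IsPrincipalIdealRing D :=
    FCPID.lim_pid G f hinj hfc D o oinj osurj otrans hcop
  have fc := FCPID.lim_fc G f hinj hfc D o oinj osurj otrans 0
  exact ⟨@FCEmbeddingIntoPID.mk A _ D _ i1 i2 (o 0) (oinj 0)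
    (fun a b ha hb hab => ⟨fc a b ha hb hab, fc b a hb ha (by rwa [mul_comm])⟩)⟩
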